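/- For all x > 0, 1 > Γ(x+1)·Γ(x/3+2) / [ (x+1)² · ((x+1)⁴/(3e⁴))^{x/3} ] > 2π/(3√3·e^{4/3}) ≈ 0.318741. -/

import Mathlib

namespace Real

/-- The trapezoid rule overestimates the integral of `1 / t` over `[a, b]`. -/
theorem log_sub_log_le_trapezoid {a b : ℝ} (ha : 0 < a) (hab : a ≤ b) :
    log b - log a ≤ (b - a) / 2 * (1 / a + 1 / b) := by
  have hb : 0 < b := ha.trans_le hab
  have h : log (b / a) ≤ sinh (log (b / a)) :=
    self_le_sinh_iff.mpr (log_nonneg ((one_le_div ha).mpr hab))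
  rw [sinh_log (div_pos hb ha), log_div hb.ne' ha.ne'] at h
  refine h.trans_eq ?_
  field_simp
  ring

/-- The trapezoid bound for the sum `1 / t + ⋯ + 1 / (t + n)`. -/
theorem log_add_nat_sub_log_le_sum {t : ℝ} (ht : 0 < t) (n : ℕ) :
    log (t + n) - log t + 1 / (2 * t) + 1 / (2 * (t + n))
      ≤ ∑ m ∈ Finset.range (n + 1), 1 / (t + m) := by
  induction n with
  | zero =>
    simp only [Nat.cast_zero, add_zero, zero_add, Finset.sum_range_one, sub_self]
    refine le_of_eq ?_
    field_simp
    norm_num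
  | succ k ih =>
    rw [Finset.sum_range_succ]
    have hk : 0 < t + k := by positivity
    have hstep := log_sub_log_le_trapezoid hk (b := t + k + 1) (by linarith)
    have e : t + ((k + 1 : ℕ) : ℝ) = t + k + 1 := by push_cast; ring
    rw [e]
    have e₁ : 1 / (2 * (t + k)) = 1 / 2 * (1 / (t + k)) := by field_simp
    have e₂ : 1 / (2 * (t + k + 1)) = 1 / 2 * (1 / (t + k + 1)) := by field_simp
    rw [e₁] at ih
    rw [e₂]
    linarith

/-- The remainder `log Γ(t) - ((t - 1/2) log t - t)` in Stirling's formula, without the constant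
`log (2π) / 2` taken off. -/
noncomputable def stirlingRemainder (t : ℝ) : ℝ :=
  log (Gamma t) - ((t - 1 / 2) * log t - t)

theorem antitoneOn_logGammaSeq_sub (n : ℕ) (hn : n ≠ 0) :
    AntitoneOn (fun t => BohrMollerup.logGammaSeq t n - ((t - 1 / 2) * log t - t))
      (Set.Ioi 0) := by
  have hderiv : ∀ t : ℝ, 0 < t →
      HasDerivAt (fun t => BohrMollerup.logGammaSeq t n - ((t - 1 / 2) * log t - t))
        (log n - (∑ m ∈ Finset.range (n + 1), 1 / (t + m)) - (log t + (t - 1 / 2) * (1 / t) - 1))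
        t := by
    intro t ht
    have hsum : HasDerivAt (fun t : ℝ => ∑ m ∈ Finset.range (n + 1), log (t + m))
        (∑ m ∈ Finset.range (n + 1), 1 / (t + m)) t :=
      HasDerivAt.fun_sum fun m _ => ((hasDerivAt_id t).add_const (m : ℝ)).log (by simp; positivity)
    have hlin := ((hasDerivAt_id t).mul_const (log n)).add_const (log (n.factorial : ℝ))
    have hmain := (((hasDerivAt_id t).sub_const (1 / 2)).mul
      ((hasDerivAt_id t).log ht.ne')).sub (hasDerivAt_id t)
    refine ((hlin.sub hsum).sub hmain).congr_deriv ?_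
    simp
  refine antitoneOn_of_deriv_nonpos (convex_Ioi 0)
    (fun t ht => (hderiv t ht).continuousAt.continuousWithinAt)
    (fun t ht => (hderiv t (interior_subset ht)).differentiableAt.differentiableWithinAt) ?_
  intro t ht
  rw [interior_Ioi] at ht
  have ht : 0 < t := ht
  rw [(hderiv t ht).deriv]
  have hsum := log_add_nat_sub_log_le_sum ht n
  have hn' : (0 : ℝ) < n := by positivity
  have hlog : log (n : ℝ) ≤ log (t + n) := log_le_log hn' (by linarith)
  have hpos : 0 < 1 / (2 * (t + n)) := by positivity
  have e : (t - 1 / 2) * (1 / t) = 1 - 1 / (2 * t) := by field_simp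
  rw [e]
  linarith

theorem antitoneOn_stirlingRemainder : AntitoneOn stirlingRemainder (Set.Ioi 0) := by
  intro s hs t ht hst
  refine le_of_tendsto_of_tendsto
    ((BohrMollerup.tendsto_log_gamma ht).sub_const _)
    ((BohrMollerup.tendsto_log_gamma hs).sub_const _) ?_
  filter_upwards [Filter.eventually_ne_atTop 0] with n hn
  exact antitoneOn_logGammaSeq_sub n hn hs ht hst

theorem log_two_pi_div_two_le_stirlingRemainder {t : ℝ} (ht : 0 < t) :
    log (2 * π) / 2 ≤ stirlingRemainder t := by
  obtain ⟨n, hn⟩ := exists_nat_ge t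
  have hn0 : (0 : ℝ) < n := ht.trans_le hn
  refine le_trans ?_ (antitoneOn_stirlingRemainder ht hn0 hn)
  have hfact := Stirling.le_log_factorial_stirling (n := n) (by rintro rfl; simp at hn0)
  rw [← Gamma_nat_eq_factorial, Gamma_add_one hn0.ne',
    log_mul hn0.ne' (Gamma_pos_of_pos hn0).ne'] at hfact
  unfold stirlingRemainder
  linarith

theorem five_thirds_lt_mul_log {t : ℝ} (ht : 0 < t) :
    5 / 3 < (2 * t + 7) / 6 * (log (t + 5) - log t) := by
  have h := le_log_one_add_of_nonneg (x := 5 / t) (by positivity)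
  have e : 1 + 5 / t = (t + 5) / t := by field_simp
  rw [e, log_div (by positivity) ht.ne'] at h
  refine lt_of_lt_of_le ?_ (mul_le_mul_of_nonneg_left h (by positivity))
  have e' : (2 * t + 7) / 6 * (2 * (5 / t) / (5 / t + 2)) = 5 / 3 * ((2 * t + 7) / (2 * t + 5)) := by
    field_simp
    ring
  have h1 : 1 < (2 * t + 7) / (2 * t + 5) := by
    rw [one_lt_div (by positivity)]
    linarith
  rw [e']
  linarith

theorem strictAntiOn_mul_log :
    StrictAntiOn (fun t : ℝ => (2 * t + 7) / 6 * (log (t + 5) - log t)) (Set.Ioi 0) := by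
  have hderiv : ∀ t : ℝ, 0 < t →
      HasDerivAt (fun t : ℝ => (2 * t + 7) / 6 * (log (t + 5) - log t))
        (1 / 3 * (log (t + 5) - log t) + (2 * t + 7) / 6 * (1 / (t + 5) - 1 / t)) t := by
    intro t ht
    have hlin := (((hasDerivAt_id t).const_mul 2).add_const 7).div_const 6
    have hlog := (((hasDerivAt_id t).add_const 5).log (by simp; positivity)).sub
      ((hasDerivAt_id t).log ht.ne')
    refine (hlin.mul hlog).congr_deriv ?_
    simp only [id_eq, Pi.sub_apply]
    ring
  refine strictAntiOn_of_deriv_neg (convex_Ioi 0)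
    (fun t ht => (hderiv t ht).continuousAt.continuousWithinAt) ?_
  intro t ht
  rw [interior_Ioi] at ht
  have ht : 0 < t := ht
  rw [(hderiv t ht).deriv]
  have h := log_sub_log_le_trapezoid ht (b := t + 5) (by linarith)
  have e : 1 / 3 * ((t + 5 - t) / 2 * (1 / t + 1 / (t + 5)))
      + (2 * t + 7) / 6 * (1 / (t + 5) - 1 / t) = -(5 / (3 * (t * (t + 5)))) := by
    field_simp
    ring
  have hpos : 0 < 5 / (3 * (t * (t + 5))) := by positivity
  linarith

/-- The logarithm of the Gamma quotient, in terms of Stirling remainders. -/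
theorem log_Gamma_mul_Gamma_div {x : ℝ} (hx : 0 < x) :
    log (Gamma (x + 1) * Gamma (x / 3 + 2)
        / ((x + 1) ^ 2 * ((x + 1) ^ 4 / (3 * exp 1 ^ 4)) ^ (x / 3)))
      = stirlingRemainder (x + 1) + stirlingRemainder (x / 3 + 2)
        + (2 * (x + 1) + 7) / 6 * (log (x + 1 + 5) - log (x + 1)) - 3 / 2 * log 3 - 3 := by
  have h₁ := Gamma_pos_of_pos (show 0 < x + 1 by positivity)
  have h₂ := Gamma_pos_of_pos (show 0 < x / 3 + 2 by positivity)
  have hs : log (x / 3 + 2) = log (x + 1 + 5) - log 3 := by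
    rw [← log_div (by positivity) (by norm_num)]
    congr 1
    ring
  rw [log_div (by positivity) (by positivity), log_mul h₁.ne' h₂.ne',
    log_mul (by positivity) (by positivity), log_rpow (by positivity),
    log_div (by positivity) (by positivity), log_mul (by norm_num) (by positivity),
    log_pow, log_pow, log_pow, log_exp, stirlingRemainder, stirlingRemainder, hs]
  push_cast
  ring

end Real

open Real in
/-- For all `x > 0`:
`1 > Γ(x+1)Γ(x/3+2) / ((x+1)²((x+1)⁴/(3e⁴))^(x/3)) > 2π/(3√3·e^(4/3))`. -/
theorem stmt10 (x : ℝ) (hx : 0 < x) :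
    2 * π / (3 * Real.sqrt 3 * Real.exp (4/3))
      < Real.Gamma (x + 1) * Real.Gamma (x/3 + 2)
        / ((x + 1) ^ 2 * ((x + 1) ^ 4 / (3 * Real.exp 1 ^ 4)) ^ (x/3)) ∧
    Real.Gamma (x + 1) * Real.Gamma (x/3 + 2)
        / ((x + 1) ^ 2 * ((x + 1) ^ 4 / (3 * Real.exp 1 ^ 4)) ^ (x/3)) < 1 := by
  have h₁ := Gamma_pos_of_pos (show 0 < x + 1 by positivity)
  have h₂ := Gamma_pos_of_pos (show 0 < x / 3 + 2 by positivity)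
  have hlog := log_Gamma_mul_Gamma_div hx
  constructor
  · rw [← log_lt_log_iff (by positivity) (by positivity), hlog,
      log_div (by positivity) (by positivity), log_mul (x := 3 * √3) (by positivity) (by positivity),
      log_mul (x := 3) (by norm_num) (by positivity), log_sqrt (by norm_num), log_exp]
    have hr₁ := log_two_pi_div_two_le_stirlingRemainder (show 0 < x + 1 by positivity)
    have hr₂ := log_two_pi_div_two_le_stirlingRemainder (show 0 < x / 3 + 2 by positivity)
    have he := five_thirds_lt_mul_log (show 0 < x + 1 by positivity)
    linarith
  · rw [← log_neg_iff (by positivity), hlog]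
    have hr₁ := antitoneOn_stirlingRemainder (Set.mem_Ioi.mpr one_pos)
      (Set.mem_Ioi.mpr (show 0 < x + 1 by positivity)) (by linarith)
    have hr₂ := antitoneOn_stirlingRemainder (Set.mem_Ioi.mpr two_pos)
      (Set.mem_Ioi.mpr (show 0 < x / 3 + 2 by positivity)) (by linarith)
    have he := strictAntiOn_mul_log (Set.mem_Ioi.mpr one_pos)
      (Set.mem_Ioi.mpr (show 0 < x + 1 by positivity)) (by linarith)
    have h6 : log 6 = log 2 + log 3 := by
      rw [← log_mul (by norm_num) (by norm_num)]
      norm_num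
    simp only [stirlingRemainder, Gamma_one, Gamma_two, log_one] at hr₁ hr₂
    norm_num [h6] at he
    simp only [stirlingRemainder] at hr₁ hr₂ ⊢
    linarith
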